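/- There exist a nonatomic σ-finite standard Borel measure space (Y,ν), an invertible conservative ergodic nonsingular transformation S of (Y,ν), and a measurable set E ⊆ Y with ν(E) > 0 and ν(Y∖E) > 0, such that S is W-measurably sensitive and S⁻¹(E) coincides with Y∖E up to a ν-null set (so S has the rotation on two points as a factor and hence is not weak mixing). -/

import Mathlib

open MeasureTheory Filter Set
open scoped ENNReal symmDiff

/-- `d` is a metric on `Y` (as a two-variable real function). -/
def IsMetricFun {Y : Type*} (d : Y → Y → ℝ) : Prop :=
  (∀ x, d x x = 0) ∧ (∀ x y, d x y = 0 → x = y) ∧ (∀ x y, d x y = d y x) ∧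
    (∀ x y z, d x z ≤ d x y + d y z)

/-- `d` is a `ν`-compatible metric. -/
def MuCompatible {Y : Type*} [MeasurableSpace Y] (ν : Measure Y) (d : Y → Y → ℝ) : Prop :=
  IsMetricFun d ∧ Measurable (fun p : Y × Y => d p.1 p.2) ∧
    ∀ᵐ x ∂ν, ∀ ε : ℝ, 0 < ε → 0 < ν {y | d x y < ε}

/-- `S` is W-measurably sensitive with respect to `ν`. -/
def WMeasurablySensitive {Y : Type*} [MeasurableSpace Y] (ν : Measure Y) (S : Y → Y) :
    Prop :=
  ∀ d : Y → Y → ℝ, MuCompatible ν d →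
    ∃ δ : ℝ, 0 < δ ∧ ∀ᵐ x ∂ν, ∀ᵐ y ∂ν,
      (δ : EReal) <
        Filter.limsup (fun n : ℕ => ((d (S^[n] x) (S^[n] y) : ℝ) : EReal)) Filter.atTop

/-- `R` is conservative with respect to `ν`. -/
def IsConservative {Y : Type*} [MeasurableSpace Y] (ν : Measure Y) (R : Y → Y) : Prop :=
  ∀ A : Set Y, MeasurableSet A → 0 < ν A → ∃ n : ℕ, 1 ≤ n ∧ 0 < ν (A ∩ R^[n] ⁻¹' A)

/-- `R` is ergodic with respect to `ν`: invariant sets are null or conull. -/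
def IsErgodicT {Y : Type*} [MeasurableSpace Y] (ν : Measure Y) (R : Y → Y) : Prop :=
  ∀ A : Set Y, MeasurableSet A → R ⁻¹' A = A → ν A = 0 ∨ ν Aᶜ = 0

open Topology

section Mixing

variable {α β : Type*} [MeasurableSpace α] [MeasurableSpace β]

/-- Convergence of a dominated sequence of measures propagates from a π-system to the generated
σ-algebra. -/
lemma tendsto_measureReal_of_piSystem {C : Set (Set α)} (hC : IsPiSystem C)
    (hgen : ‹MeasurableSpace α› = MeasurableSpace.generateFrom C) {μ m' : Measure α}
    [IsFiniteMeasure μ] [IsFiniteMeasure m'] {m : ℕ → Measure α} (hle : ∀ n, m n ≤ μ)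
    (huniv : Tendsto (fun n => (m n).real univ) atTop (𝓝 (m'.real univ)))
    (hbasic : ∀ A ∈ C, Tendsto (fun n => (m n).real A) atTop (𝓝 (m'.real A))) {A : Set α}
    (hA : MeasurableSet A) : Tendsto (fun n => (m n).real A) atTop (𝓝 (m'.real A)) := by
  have hfin n : IsFiniteMeasure (m n) := isFiniteMeasure_of_le μ (hle n)
  induction A, hA using MeasurableSpace.induction_on_inter hgen hC with
  | empty => simp
  | basic A hA => exact hbasic A hA
  | compl A hA ih =>
    simp_rw [measureReal_compl hA]
    exact huniv.sub ih
  | iUnion f hd hf ih =>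
    have key (ρ : Measure α) [IsFiniteMeasure ρ] :
        HasSum (fun i => ρ.real (f i)) (ρ.real (⋃ i, f i)) := by
      have h := measure_iUnion (μ := ρ) hd hf
      have hne : ∑' i, ρ (f i) ≠ ∞ := h ▸ measure_ne_top ρ _
      rw [Measure.real, h, ENNReal.tsum_toReal_eq fun i => measure_ne_top ρ _]
      exact ENNReal.hasSum_toReal hne
    simp_rw [← fun n => (key (m n)).tsum_eq, ← (key m').tsum_eq]
    refine tendsto_tsum_of_dominated_convergence (key μ).summable ih (.of_forall fun n i => ?_)
    rw [Real.norm_of_nonneg measureReal_nonneg]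
    exact ENNReal.toReal_mono (measure_ne_top _ _) (hle n _)

/-- `T` is (strongly) mixing with respect to `μ`. -/
def IsMixing (T : α → α) (μ : Measure α) : Prop :=
  ∀ A B : Set α, MeasurableSet A → MeasurableSet B →
    Tendsto (fun n => μ.real (A ∩ T^[n] ⁻¹' B)) atTop (𝓝 (μ.real A * μ.real B))

lemma MeasureTheory.MeasurePreserving.isMixing_of_piSystem {C : Set (Set α)} (hC : IsPiSystem C)
    (hgen : ‹MeasurableSpace α› = MeasurableSpace.generateFrom C) {μ : Measure α}
    [IsProbabilityMeasure μ] {T : α → α} (hT : MeasurePreserving T μ μ)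
    (hbasic : ∀ A ∈ C, ∀ B ∈ C,
      Tendsto (fun n => μ.real (A ∩ T^[n] ⁻¹' B)) atTop (𝓝 (μ.real A * μ.real B))) :
    IsMixing T μ := by
  have hCm A (hA : A ∈ C) : MeasurableSet A := by
    rw [hgen]; exact MeasurableSpace.measurableSet_generateFrom hA
  have h₁ : ∀ A, MeasurableSet A → ∀ B ∈ C,
      Tendsto (fun n => μ.real (A ∩ T^[n] ⁻¹' B)) atTop (𝓝 (μ.real A * μ.real B)) := by
    intro A hA B hB
    have hr n (E : Set α) (hE : MeasurableSet E) :
        (μ.restrict (T^[n] ⁻¹' B)).real E = μ.real (E ∩ T^[n] ⁻¹' B) := measureReal_restrict_apply hE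
    have := μ.smul_finite (measure_ne_top μ B)
    have := tendsto_measureReal_of_piSystem hC hgen (μ := μ) (m' := (μ B) • μ)
      (m := fun n => μ.restrict (T^[n] ⁻¹' B)) (fun n => Measure.restrict_le_self) ?_ ?_ hA
    · simp_rw [hr _ A hA, measureReal_ennreal_smul_apply] at this
      rwa [mul_comm]
    · simp_rw [hr _ univ .univ, univ_inter, (hT.iterate _).measureReal_preimage
        (hCm B hB).nullMeasurableSet, measureReal_ennreal_smul_apply, probReal_univ, mul_one]
      exact tendsto_const_nhds
    · intro E hE
      simp_rw [hr _ E (hCm E hE), measureReal_ennreal_smul_apply]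
      rw [mul_comm]
      exact hbasic E hE B hB
  intro A B hA hB
  have hr n (E : Set α) (hE : MeasurableSet E) :
      ((μ.restrict A).map T^[n]).real E = μ.real (A ∩ T^[n] ⁻¹' E) := by
    rw [map_measureReal_apply (hT.iterate n).measurable hE,
      measureReal_restrict_apply ((hT.iterate n).measurable hE), inter_comm]
  have := μ.smul_finite (measure_ne_top μ A)
  have := tendsto_measureReal_of_piSystem hC hgen (μ := μ) (m' := (μ A) • μ)
    (m := fun n => (μ.restrict A).map T^[n]) (fun n => ?_) ?_ ?_ hB
  · simp_rw [hr _ B hB, measureReal_ennreal_smul_apply] at this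
    exact this
  · conv_rhs => rw [← (hT.iterate n).map_eq]
    exact Measure.map_mono Measure.restrict_le_self (hT.iterate n).measurable
  · simp_rw [hr _ univ .univ, preimage_univ, inter_univ, measureReal_ennreal_smul_apply,
      probReal_univ, mul_one]
    exact tendsto_const_nhds
  · intro E hE
    simp_rw [hr _ E (hCm E hE), measureReal_ennreal_smul_apply]
    exact h₁ A hA E hE

lemma IsMixing.prodMap {T : α → α} {R : β → β} {μ : Measure α} {ρ : Measure β}
    [IsProbabilityMeasure μ] [IsProbabilityMeasure ρ] (hTm : MeasurePreserving T μ μ)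
    (hRm : MeasurePreserving R ρ ρ) (hT : IsMixing T μ) (hR : IsMixing R ρ) :
    IsMixing (Prod.map T R) (μ.prod ρ) := by
  refine (hTm.prod hRm).isMixing_of_piSystem isPiSystem_prod generateFrom_prod.symm ?_
  rintro _ ⟨A₁, hA₁, A₂, hA₂, rfl⟩ _ ⟨B₁, hB₁, B₂, hB₂, rfl⟩
  simp_rw [Prod.map_iterate, preimage_prod_map_prod, prod_inter_prod, measureReal_prod_prod]
  convert (hT A₁ B₁ hA₁ hB₁).mul (hR A₂ B₂ hA₂ hB₂) using 2
  ring

lemma IsMixing.ae_frequently_mem {T : α → α} {μ : Measure α} [IsProbabilityMeasure μ]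
    (hTm : Measurable T) (hT : IsMixing T μ) {φ : ℕ → ℕ} (hφ : Tendsto φ atTop atTop) {B : Set α}
    (hB : MeasurableSet B) (hB0 : μ B ≠ 0) : ∀ᵐ x ∂μ, ∃ᶠ n in atTop, T^[φ n] x ∈ B := by
  simp_rw [frequently_atTop, ae_all_iff]
  intro k
  set N : Set α := ⋂ n ≥ k, (T^[φ n] ⁻¹' B)ᶜ with hN
  have hNm : MeasurableSet N :=
    .iInter fun n => .iInter fun _ => (hTm.iterate _ hB).compl
  have hNB : Tendsto (fun n => μ.real (N ∩ T^[φ n] ⁻¹' B)) atTop (𝓝 0) := by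
    refine tendsto_const_nhds.congr' ?_
    filter_upwards [eventually_ge_atTop k] with n hn
    have : N ∩ T^[φ n] ⁻¹' B = ∅ :=
      eq_empty_of_forall_notMem fun x hx => mem_iInter₂.1 hx.1 n hn hx.2
    simp [this]
  have h0 := tendsto_nhds_unique hNB ((hT N B hNm hB).comp hφ)
  have hN0 : μ N = 0 := by
    rcases mul_eq_zero.1 h0.symm with h | h
    · exact (measureReal_eq_zero_iff (measure_ne_top _ _)).1 h
    · exact absurd ((measureReal_eq_zero_iff (measure_ne_top _ _)).1 h) hB0
  refine measure_mono_null (fun x hx => ?_) hN0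
  simp only [hN, mem_iInter]
  intro n hn hxn
  exact hx ⟨n, hn, hxn⟩

lemma IsMixing.measure_eq_zero_or_one {T : α → α} {μ : Measure α} [IsProbabilityMeasure μ]
    (hT : IsMixing T μ) {A : Set α} (hA : MeasurableSet A) {k : ℕ} (hk : 0 < k)
    (hinv : T^[k] ⁻¹' A = A) : μ.real A = 0 ∨ μ.real A = 1 := by
  have hinv' n : T^[k * n] ⁻¹' A = A := by
    rw [Function.iterate_mul, Set.preimage_iterate_eq]
    exact Function.iterate_fixed hinv n
  have h := (hT A A hA hA).comp (tendsto_id.const_mul_atTop' hk)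
  simp only [Function.comp_def, id, hinv', inter_self] at h
  have := tendsto_nhds_unique tendsto_const_nhds h
  rcases eq_or_ne (μ.real A) 0 with h0 | h0
  · exact .inl h0
  · exact .inr ((mul_eq_left₀ h0).1 this.symm)

end Mixing

section Shift

variable {Ω : Type*} [MeasurableSpace Ω]

/-- The left shift on bi-infinite sequences. -/
def bilateralShift (Ω : Type*) [MeasurableSpace Ω] : (ℤ → Ω) ≃ᵐ (ℤ → Ω) where
  toFun x i := x (i + 1)
  invFun x i := x (i - 1)
  left_inv x := by ext i; simp
  right_inv x := by ext i; simp
  measurable_toFun := measurable_pi_lambda _ fun i => measurable_pi_apply (i + 1)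
  measurable_invFun := measurable_pi_lambda _ fun i => measurable_pi_apply (i - 1)

lemma bilateralShift_iterate_apply (n : ℕ) (x : ℤ → Ω) (i : ℤ) :
    (bilateralShift Ω)^[n] x i = x (i + n) := by
  induction n generalizing x with
  | zero => simp
  | succ n ih =>
    rw [Function.iterate_succ_apply, ih]
    change x (i + n + 1) = _
    push_cast
    ring_nf

lemma bilateralShift_iterate_preimage_pi (n : ℕ) (s : Finset ℤ) (t : ℤ → Set Ω) :
    (bilateralShift Ω)^[n] ⁻¹' (s : Set ℤ).pi t =
      (s.map (Equiv.addRight (n : ℤ)).toEmbedding : Set ℤ).pi fun i => t (i - n) := by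
  ext x
  simp [bilateralShift_iterate_apply, Set.mem_pi, -Finset.coe_map, -Finset.mem_map_equiv,
    Finset.mem_map]

variable (ρ : Measure Ω) [IsProbabilityMeasure ρ]

lemma measurePreserving_bilateralShift :
    MeasurePreserving (bilateralShift Ω) (Measure.infinitePi fun _ : ℤ => ρ)
      (Measure.infinitePi fun _ => ρ) := by
  refine ⟨(bilateralShift Ω).measurable, Measure.eq_infinitePi _ fun s t ht => ?_⟩
  have h := bilateralShift_iterate_preimage_pi 1 s t
  rw [Function.iterate_one] at h
  rw [MeasurableEquiv.map_apply, h, Measure.infinitePi_pi _ fun i _ => ht _]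
  simp

lemma isMixing_bilateralShift :
    IsMixing (bilateralShift Ω) (Measure.infinitePi fun _ : ℤ => ρ) := by
  refine (measurePreserving_bilateralShift ρ).isMixing_of_piSystem
    (isPiSystem_squareCylinders (fun _ => MeasurableSpace.isPiSystem_measurableSet)
      fun _ => MeasurableSet.univ) generateFrom_squareCylinders.symm ?_
  rintro _ ⟨s, (a : ℤ → Set Ω), ha, rfl⟩ _ ⟨t, (b : ℤ → Set Ω), hb, rfl⟩
  replace ha i : MeasurableSet (a i) := ha i (mem_univ i)
  replace hb i : MeasurableSet (b i) := hb i (mem_univ i)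
  classical
  refine tendsto_const_nhds.congr' ?_
  obtain ⟨u, hu⟩ := s.bddAbove
  obtain ⟨l, hl⟩ := t.bddBelow
  filter_upwards [eventually_gt_atTop (u - l).toNat] with n hn
  set t' := t.map (Equiv.addRight (n : ℤ)).toEmbedding with ht'
  have hd : Disjoint s t' := by
    rw [Finset.disjoint_left]
    intro i his hit
    obtain ⟨j, hj, rfl⟩ := Finset.mem_map.1 hit
    have h₁ := hu his
    have h₂ := hl hj
    simp only [Equiv.coe_toEmbedding, Equiv.coe_addRight] at h₁
    omega
  set c : ℤ → Set Ω := fun i => if i ∈ s then a i else b (i - n) with hc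
  have hcm i : MeasurableSet (c i) := by
    simp only [hc]; split_ifs <;> simp [ha, hb]
  have hcs i (hi : i ∈ s) : c i = a i := if_pos hi
  have hct i (hi : i ∈ t') : c i = b (i - n) := if_neg (Finset.disjoint_right.1 hd hi)
  have hpi : (s : Set ℤ).pi a ∩ (bilateralShift Ω)^[n] ⁻¹' (t : Set ℤ).pi b =
      ((s ∪ t' : Finset ℤ) : Set ℤ).pi c := by
    rw [bilateralShift_iterate_preimage_pi, Finset.coe_union, union_pi]
    exact congrArg₂ _ (pi_congr rfl fun i hi => (hcs i hi).symm)
      (pi_congr rfl fun i hi => (hct i hi).symm)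
  rw [hpi, Measure.real, Measure.real, Measure.real, ← ENNReal.toReal_mul,
    Measure.infinitePi_pi _ fun i _ => ha i, Measure.infinitePi_pi _ fun i _ => hb i,
    Measure.infinitePi_pi _ fun i _ => hcm i, Finset.prod_union hd,
    Finset.prod_congr rfl fun i hi => congrArg ρ (hcs i hi),
    Finset.prod_congr rfl fun i hi => congrArg ρ (hct i hi)]
  simp [ht']

lemma infinitePi_singleton_eq_zero [NullSingletonClass ρ] [MeasurableSingletonClass Ω] (x : ℤ → Ω) :
    Measure.infinitePi (fun _ : ℤ => ρ) {x} = 0 := by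
  refine measure_mono_null (t := ((({0} : Finset ℤ) : Set ℤ).pi fun i => {x i})) ?_ ?_
  · rintro _ rfl i _
    rfl
  · rw [Measure.infinitePi_pi _ fun i _ => measurableSet_singleton _]
    simp

end Shift

section TwoPointExtension

variable {X : Type*} [MeasurableSpace X]

/-- The product of `T` with the rotation on two points. -/
def flipExtension (T : X ≃ᵐ X) : X × Bool ≃ᵐ X × Bool :=
  T.prodCongr ⟨Equiv.boolNot, measurable_of_countable _, measurable_of_countable _⟩

@[simp]
lemma flipExtension_apply (T : X ≃ᵐ X) (x : X) (b : Bool) : flipExtension T (x, b) = (T x, !b) :=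
  rfl

lemma flipExtension_iterate_two_mul (T : X ≃ᵐ X) (n : ℕ) (x : X) (b : Bool) :
    (flipExtension T)^[2 * n] (x, b) = (T^[2 * n] x, b) := by
  induction n with
  | zero => rfl
  | succ n ih => simp [mul_add, Function.iterate_succ_apply', ih]

/-- The product of `μ` with the counting measure on two points. -/
noncomputable def twoPointMeasure (μ : Measure X) : Measure (X × Bool) :=
  μ.map (·, true) + μ.map (·, false)

instance (μ : Measure X) [IsFiniteMeasure μ] : IsFiniteMeasure (twoPointMeasure μ) := by
  unfold twoPointMeasure; infer_instance

lemma twoPointMeasure_apply (μ : Measure X) (s : Set (X × Bool)) :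
    twoPointMeasure μ s = μ {x | (x, true) ∈ s} + μ {x | (x, false) ∈ s} := by
  rw [twoPointMeasure, Measure.add_apply,
    (measurableEmbedding_prod_mk_right true).map_apply,
    (measurableEmbedding_prod_mk_right false).map_apply]
  rfl

lemma twoPointMeasure_eq_zero {μ : Measure X} {s : Set (X × Bool)} :
    twoPointMeasure μ s = 0 ↔ ∀ b, μ {x | (x, b) ∈ s} = 0 := by
  rw [twoPointMeasure_apply, add_eq_zero, Bool.forall_bool, and_comm]

lemma ae_twoPointMeasure {μ : Measure X} {p : X × Bool → Prop} :
    (∀ᵐ y ∂twoPointMeasure μ, p y) ↔ ∀ b, ∀ᵐ x ∂μ, p (x, b) :=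
  twoPointMeasure_eq_zero

lemma measurePreserving_flipExtension {μ : Measure X} {T : X ≃ᵐ X} (hT : MeasurePreserving T μ μ) :
    MeasurePreserving (flipExtension T) (twoPointMeasure μ) (twoPointMeasure μ) := by
  refine ⟨(flipExtension T).measurable, Measure.ext fun s hs => ?_⟩
  rw [MeasurableEquiv.map_apply, twoPointMeasure_apply, twoPointMeasure_apply, add_comm]
  congr 1
  · exact hT.measure_preimage_equiv {x | (x, true) ∈ s}
  · exact hT.measure_preimage_equiv {x | (x, false) ∈ s}

variable {μ : Measure X} [IsProbabilityMeasure μ] {T : X ≃ᵐ X}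

lemma isErgodicT_flipExtension (hTm : MeasurePreserving T μ μ) (hT : IsMixing T μ) :
    IsErgodicT (twoPointMeasure μ) (flipExtension T) := by
  intro A hA hinv
  set s : Bool → Set X := fun b => {x | (x, b) ∈ A} with hs
  have hsm b : MeasurableSet (s b) := measurable_prodMk_right hA
  have hTs b : T ⁻¹' s b = s (!b) := by
    ext x
    change (T x, b) ∈ A ↔ (x, !b) ∈ A
    simpa using Set.ext_iff.1 hinv (x, !b)
  have hTT b : T^[2] ⁻¹' s b = s b := by
    rw [Function.iterate_succ, Function.iterate_one, preimage_comp, hTs, hTs, Bool.not_not]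
  have hμ b : μ (s b) = μ (s true) := by
    cases b
    · rw [← Bool.not_true, ← hTs, hTm.measure_preimage_equiv]
    · rfl
  rcases hT.measure_eq_zero_or_one (hsm true) two_pos (hTT true) with h | h
  · exact .inl (twoPointMeasure_eq_zero.2 fun b => (hμ b).trans ((measureReal_eq_zero_iff (measure_ne_top _ _)).1 h))
  · refine .inr (twoPointMeasure_eq_zero.2 fun b => ?_)
    have h1 : μ (s true) = 1 := (ENNReal.toReal_eq_one_iff _).1 h
    exact (prob_compl_eq_zero_iff (hsm b)).2 ((hμ b).trans h1)

lemma wMeasurablySensitive_flipExtension [NullSingletonClass μ] (hTm : MeasurePreserving T μ μ)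
    (hT : IsMixing T μ) : WMeasurablySensitive (twoPointMeasure μ) (flipExtension T) := by
  rintro d ⟨⟨hdself, hd0, hdsymm, hdtri⟩, hdm, -⟩
  have hdnn x y : 0 ≤ d x y := by
    linarith [hdself x, hdsymm x y, hdtri x y x]
  have hgm (i : Bool × Bool) : Measurable fun p : X × X => d (p.1, i.1) (p.2, i.2) :=
    hdm.comp (f := fun p : X × X => ((p.1, i.1), (p.2, i.2))) (by fun_prop)
  have hex (i : Bool × Bool) : ∃ δ : ℝ, 0 < δ ∧
      μ.prod μ {p | δ < d (p.1, i.1) (p.2, i.2)} ≠ 0 := by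
    by_contra! hcon
    have hpos : μ.prod μ {p | 0 < d (p.1, i.1) (p.2, i.2)} = 0 := by
      refine measure_mono_null (t := ⋃ n : ℕ, {p | 1 / ((n : ℝ) + 1) < d (p.1, i.1) (p.2, i.2)})
        (fun p (hp : 0 < d _ _) => mem_iUnion.2 (exists_nat_one_div_lt hp)) (measure_iUnion_null fun n => ?_)
      exact hcon _ Nat.one_div_pos_of_nat
    have hdiag : μ.prod μ {p | 0 < d (p.1, i.1) (p.2, i.2)}ᶜ = 0 := by
      rw [Measure.measure_prod_null (measurableSet_lt measurable_const (hgm i)).compl]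
      refine .of_forall fun x => measure_mono_null (t := {x}) (fun y hy => ?_) (measure_singleton x)
      have h0 := hd0 (x, i.1) (y, i.2) (le_antisymm (not_lt.1 hy) (hdnn _ _))
      exact (congrArg Prod.fst h0).symm
    have := measure_union_null hpos hdiag
    rw [union_compl_self, measure_univ] at this
    exact one_ne_zero this
  choose δ hδ hδμ using hex
  obtain ⟨i₀, hi₀⟩ := Finite.exists_min δ
  refine ⟨δ i₀ / 2, half_pos (hδ i₀), ?_⟩
  have hvisit (i : Bool × Bool) : ∀ᵐ x ∂μ, ∀ᵐ y ∂μ, ∃ᶠ n : ℕ in atTop,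
      δ i < d (T^[2 * n] x, i.1) (T^[2 * n] y, i.2) := by
    have := (hT.prodMap hTm hTm hT).ae_frequently_mem (T.measurable.prodMap T.measurable)
      (tendsto_id.const_mul_atTop' two_pos) (measurableSet_lt measurable_const (hgm i)) (hδμ i)
    filter_upwards [Measure.ae_ae_of_ae_prod this] with x hx
    filter_upwards [hx] with y hy
    simpa [Prod.map_iterate] using hy
  refine ae_twoPointMeasure.2 fun b => ?_
  filter_upwards [hvisit (b, true), hvisit (b, false)] with x hxt hxf
  refine ae_twoPointMeasure.2 fun c => ?_
  have hx : ∀ᵐ y ∂μ, ∃ᶠ n : ℕ in atTop,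
      δ (b, c) < d (T^[2 * n] x, b) (T^[2 * n] y, c) := by
    cases c
    exacts [hxf, hxt]
  filter_upwards [hx] with y hy
  have hfreq : ∃ᶠ n : ℕ in atTop, ((δ i₀ : ℝ) : EReal) ≤
      (d ((flipExtension T)^[n] (x, b)) ((flipExtension T)^[n] (y, c)) : ℝ) := by
    refine (tendsto_id.const_mul_atTop' (two_pos (α := ℕ))).frequently (hy.mono fun n hn => ?_)
    rw [id, flipExtension_iterate_two_mul, flipExtension_iterate_two_mul]
    exact EReal.coe_le_coe_iff.2 ((hi₀ _).trans hn.le)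
  exact (EReal.coe_lt_coe_iff.2 (half_lt_self (hδ i₀))).trans_le (le_limsup_of_frequently_le hfreq)

end TwoPointExtension

/-- There is an invertible conservative ergodic nonsingular transformation `S` of a
nonatomic σ-finite standard Borel measure space which is W-measurably sensitive and has a
set `E` of positive, non-full measure with `S⁻¹(E) = Y ∖ E` up to a null set. -/
theorem exists_wSensitive_with_two_point_rotation_factor :
    ∃ (Y : Type) (_ : MeasurableSpace Y) (_ : StandardBorelSpace Y) (ν : Measure Y)
      (_ : SigmaFinite ν) (S : Y ≃ᵐ Y) (E : Set Y),
      (∀ y : Y, ν {y} = 0) ∧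
      Measure.QuasiMeasurePreserving (⇑S) ν ν ∧
      Measure.QuasiMeasurePreserving (⇑S.symm) ν ν ∧
      IsConservative ν S ∧ IsErgodicT ν S ∧
      MeasurableSet E ∧ 0 < ν E ∧ 0 < ν Eᶜ ∧
      WMeasurablySensitive ν S ∧
      ν ((⇑S ⁻¹' E) ∆ Eᶜ) = 0 := by
  let μ : Measure (ℤ → unitInterval) := Measure.infinitePi fun _ => volume
  have hTm : MeasurePreserving (bilateralShift unitInterval) μ μ :=
    measurePreserving_bilateralShift _
  have hT : IsMixing (bilateralShift unitInterval) μ := isMixing_bilateralShift _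
  have hμ : NullSingletonClass μ := ⟨infinitePi_singleton_eq_zero _⟩
  have hS := measurePreserving_flipExtension hTm
  refine ⟨(ℤ → unitInterval) × Bool, inferInstance, inferInstance, twoPointMeasure μ,
    inferInstance, flipExtension (bilateralShift unitInterval), {y | y.2 = true}, fun y => ?_,
    hS.quasiMeasurePreserving, hS.symm.quasiMeasurePreserving, fun A hA hA0 => ?_,
    isErgodicT_flipExtension hTm hT, measurable_snd (measurableSet_singleton true), ?_, ?_,
    wMeasurablySensitive_flipExtension hTm hT, ?_⟩
  · exact twoPointMeasure_eq_zero.2 fun b =>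
      measure_mono_null (fun x hx => congrArg Prod.fst hx) (measure_singleton y.1)
  · obtain ⟨n, hn, h⟩ :=
      hS.conservative.exists_gt_measure_inter_ne_zero hA.nullMeasurableSet hA0.ne' 0
    exact ⟨n, hn, pos_iff_ne_zero.2 h⟩
  · simp [twoPointMeasure_apply]
  · simp [twoPointMeasure_apply]
  · refine twoPointMeasure_eq_zero.2 fun b => ?_
    cases b <;> simp [mem_symmDiff]
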